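/- arXiv:1912.03635 — 5 statements merged into one kernel-verified Lean document; each statement's English description precedes it below -/
import Mathlib

section
/- Let X be a reflexive Banach space, Y a finite-dimensional Banach space, T a bounded linear operator from X to Y with ‖T‖ = 1, and W a finite-dimensional linear subspace of L(X,Y). Then T ⊥_B W if and only if there exist a natural number h ≥ 1, vectors x_1,…,x_h ∈ M_T ∩ Ext(B_X), functionals y_i* ∈ Ext(J(T x_i)) for 1 ≤ i ≤ h, and scalars λ_1,…,λ_h > 0 with ∑_{i=1}^h λ_i = 1, such that ∑_{i=1}^h λ_i y_i*(A x_i) = 0 for every A ∈ W. -/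
/-- `x` is an extreme point (with respect to real convex combinations) of the set `s`
in a vector space over `𝕜 = ℝ` or `ℂ`. -/
def RealExtremePoint (𝕜 : Type*) {E : Type*} [RCLike 𝕜] [AddCommGroup E] [Module 𝕜 E]
    (s : Set E) (x : E) : Prop :=
  x ∈ s ∧ ∀ y ∈ s, ∀ z ∈ s, ∀ t : ℝ, 0 < t → t < 1 →
    x = ((t : 𝕜)) • y + (((1 - t : ℝ) : 𝕜)) • z → y = x ∧ z = x

theorem isCompact_convexHull_of_finiteDimensional {F : Type*} [NormedAddCommGroup F]
    [NormedSpace ℝ F] [FiniteDimensional ℝ F] {s : Set F} (hs : IsCompact s) :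
    IsCompact (convexHull ℝ s) := by
  let comb (k : ℕ) (p : (Fin k → ℝ) × (Fin k → F)) : F := ∑ i, p.1 i • p.2 i
  have hcomb (k : ℕ) : Continuous (comb k) := by fun_prop
  have heq : convexHull ℝ s = ⋃ k ∈ Finset.range (Module.finrank ℝ F + 2),
      comb k '' (stdSimplex ℝ (Fin k) ×ˢ Set.univ.pi fun _ => s) := by
    refine Set.Subset.antisymm (fun x hx => ?_) (Set.iUnion₂_subset fun k _ => ?_)
    · obtain ⟨ι, _, z, w, hz, hind, hw, hw1, rfl⟩ := eq_pos_convex_span_of_mem_convexHull hx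
      have hcard := hind.card_le_finrank_succ.trans
        (Nat.add_le_add_right (Submodule.finrank_le _) 1)
      let e := Fintype.equivFin ι
      refine Set.mem_iUnion₂.2 ⟨Fintype.card ι, Finset.mem_range.2 (by omega),
        (w ∘ e.symm, z ∘ e.symm), ⟨⟨fun i => (hw _).le, ?_⟩, fun i _ => hz ⟨_, rfl⟩⟩, ?_⟩
      · simpa using (e.symm.sum_comp w).trans hw1
      · exact e.symm.sum_comp fun i => w i • z i
    · rintro _ ⟨⟨w, z⟩, ⟨⟨hw0, hw1⟩, hz⟩, rfl⟩
      exact (convex_convexHull ℝ s).sum_mem (fun i _ => hw0 i) hw1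
        fun i _ => subset_convexHull ℝ s (hz i trivial)
  rw [heq]
  exact (Finset.range _).isCompact_biUnion fun k _ =>
    ((isCompact_stdSimplex ℝ (Fin k)).prod (isCompact_univ_pi fun _ => hs)).image (hcomb k)

theorem Convex.exists_ne_zero_forall_le_of_notMem {F : Type*} [NormedAddCommGroup F]
    [NormedSpace ℝ F] [FiniteDimensional ℝ F] {D : Set F} (hD : Convex ℝ D) {v : F}
    (hv : v ∉ D) (hne : D.Nonempty) : ∃ g : StrongDual ℝ F, g ≠ 0 ∧ ∀ d ∈ D, g d ≤ g v := by
  by_cases hint : (interior D).Nonempty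
  · exact geometric_hahn_banach_of_nonempty_interior_point hD
      (fun h => hv (interior_subset h)) hint
  · rw [hD.interior_nonempty_iff_affineSpan_eq_top,
      AffineSubspace.affineSpan_eq_top_iff_vectorSpan_eq_top_of_nonempty ℝ _ _ hne] at hint
    obtain ⟨f, hf0, hf⟩ := Submodule.exists_le_ker_of_lt_top _ (lt_top_iff_ne_top.2 hint)
    obtain ⟨d₀, hd₀⟩ := hne
    have hconst (d) (hd : d ∈ D) : f d = f d₀ := by
      have := hf (vsub_mem_vectorSpan ℝ hd hd₀)
      simpa [sub_eq_zero] using this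
    have hg0 : LinearMap.toContinuousLinearMap f ≠ 0 := by simpa using hf0
    rcases le_total (f d₀) (f v) with h | h
    · exact ⟨LinearMap.toContinuousLinearMap f, hg0, fun d hd => by simpa [hconst d hd] using h⟩
    · exact ⟨-LinearMap.toContinuousLinearMap f, neg_ne_zero.2 hg0,
        fun d hd => by simpa [hconst d hd] using h⟩

section KreinMilman

variable {E : Type*} [AddCommGroup E] [Module ℝ E] [TopologicalSpace E] [T2Space E]
  [IsTopologicalAddGroup E] [ContinuousSMul ℝ E] [LocallyConvexSpace ℝ E]

theorem IsCompact.image_subset_convexHull_image_extremePoints {F : Type*} [NormedAddCommGroup F]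
    [NormedSpace ℝ F] [FiniteDimensional ℝ F] {K : Set E} (hK : IsCompact K) (hKc : Convex ℝ K)
    (L : E →L[ℝ] F) : L '' K ⊆ convexHull ℝ (L '' K.extremePoints ℝ) := by
  induction hn : Module.finrank ℝ F using Nat.strong_induction_on generalizing F K with
  | _ n ih =>
  rintro _ ⟨x₀, hx₀, rfl⟩
  by_contra hv
  obtain ⟨g, hg0, hg⟩ := (convex_convexHull ℝ _).exists_ne_zero_forall_le_of_notMem hv
    ((hK.extremePoints_nonempty ⟨x₀, hx₀⟩).image L).convexHull
  have hmax : ∀ x ∈ K, g (L x) ≤ g (L x₀) := by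
    rw [← closure_convexHull_extremePoints hK hKc]
    refine closure_minimal (convexHull_min (fun x hx => ?_) ?_) ?_
    · exact hg _ (subset_convexHull ℝ _ ⟨x, hx, rfl⟩)
    · exact convex_halfSpace_le ((g.comp L).toLinearMap.isLinear) _
    · exact isClosed_le (g.comp L).continuous continuous_const
  obtain ⟨w, hw⟩ : ∃ w, g w = 1 := by
    obtain ⟨u, hu⟩ := DFunLike.ne_iff.1 hg0
    exact ⟨(g u)⁻¹ • u, by simpa using inv_mul_cancel₀ hu⟩
  let L' : E →L[ℝ] g.ker := (L - (g.comp L).smulRight w).codRestrict g.ker fun x => by simp [hw]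
  have hface : IsExposed ℝ K {x ∈ K | ∀ y ∈ K, g (L y) ≤ g (L x)} := fun _ => ⟨g.comp L, rfl⟩
  have hlt : Module.finrank ℝ g.ker < n := by
    rw [← hn]
    refine Submodule.finrank_lt fun h => hg0 ?_
    ext x
    simpa using (h ▸ Submodule.mem_top : x ∈ g.ker)
  have hmem := ih _ hlt (hface.isCompact hK) (hface.convex hKc) L' rfl ⟨x₀, ⟨hx₀, hmax⟩, rfl⟩
  have hsub : convexHull ℝ (L' '' ({x ∈ K | ∀ y ∈ K, g (L y) ≤ g (L x)}).extremePoints ℝ) ⊆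
      {z : g.ker | (z : F) + g (L x₀) • w ∈ convexHull ℝ (L '' K.extremePoints ℝ)} := by
    refine convexHull_min ?_ ?_
    · rintro _ ⟨x, hx, rfl⟩
      have hgx : g (L x) = g (L x₀) := le_antisymm (hmax x hx.1.1) (hx.1.2 x₀ hx₀)
      refine subset_convexHull ℝ _
        ⟨x, hface.isExtreme.extremePoints_subset_extremePoints hx, ?_⟩
      simp [L', hgx]
    · exact ((convex_convexHull ℝ (L '' K.extremePoints ℝ)).translate_preimage_left
        (g (L x₀) • w)).linear_preimage g.ker.subtype
  exact hv (by simpa [L'] using hsub hmem)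

theorem exists_extremePoints_of_mem_extremePoints_convexHull_image2
    {E' F : Type*} [AddCommGroup E'] [Module ℝ E'] [TopologicalSpace E'] [T2Space E']
    [IsTopologicalAddGroup E'] [ContinuousSMul ℝ E'] [LocallyConvexSpace ℝ E']
    [NormedAddCommGroup F] [NormedSpace ℝ F]
    {K : Set E} {K' : Set E'} (hK : IsCompact K) (hK' : IsCompact K') (Φ : E →ₗ[ℝ] E' →ₗ[ℝ] F)
    (hΦ : Continuous fun p : E × E' => Φ p.1 p.2) {e : F}
    (he : e ∈ (convexHull ℝ (Set.image2 (fun x y => Φ x y) K K')).extremePoints ℝ) :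
    ∃ x ∈ K.extremePoints ℝ, ∃ y ∈ K'.extremePoints ℝ, Φ x y = e := by
  obtain ⟨x₀, hx₀, y₀, hy₀, h₀⟩ := extremePoints_convexHull_subset he
  have hmem {x y} (hx : x ∈ K) (hy : y ∈ K') :
      Φ x y ∈ convexHull ℝ (Set.image2 (fun x y => Φ x y) K K') :=
    subset_convexHull ℝ _ ⟨x, hx, y, hy, rfl⟩
  have hface : IsExtreme ℝ K {x ∈ K | Φ x y₀ = e} := by
    refine ⟨Set.sep_subset _ _, ?_⟩
    rintro a ha b hb _ ⟨_, hc⟩ ⟨s, t, hs, ht, hst, rfl⟩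
    exact ⟨ha, he.2 (hmem ha hy₀) (hmem hb hy₀) ⟨s, t, hs, ht, hst, by simpa using hc⟩⟩
  have hcpt : IsCompact {x ∈ K | Φ x y₀ = e} :=
    hK.inter_right (isClosed_singleton.preimage (hΦ.comp (by fun_prop : Continuous (·, y₀))))
  obtain ⟨x, hx⟩ := hcpt.extremePoints_nonempty ⟨x₀, hx₀, h₀⟩
  have hface' : IsExtreme ℝ K' {y ∈ K' | Φ x y = e} := by
    refine ⟨Set.sep_subset _ _, ?_⟩
    rintro a ha b hb _ ⟨_, hc⟩ ⟨s, t, hs, ht, hst, rfl⟩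
    exact ⟨ha, he.2 (hmem hx.1.1 ha) (hmem hx.1.1 hb) ⟨s, t, hs, ht, hst, by simpa using hc⟩⟩
  have hcpt' : IsCompact {y ∈ K' | Φ x y = e} :=
    hK'.inter_right (isClosed_singleton.preimage (hΦ.comp (by fun_prop : Continuous (x, ·))))
  obtain ⟨y, hy⟩ := hcpt'.extremePoints_nonempty ⟨y₀, hy₀, hx.1.2⟩
  exact ⟨x, hface.extremePoints_subset_extremePoints hx, y,
    hface'.extremePoints_subset_extremePoints hy, hy.1.2⟩

theorem convexHull_image2_subset_convexHull_image2_extremePoints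
    {E' F : Type*} [AddCommGroup E'] [Module ℝ E'] [TopologicalSpace E'] [T2Space E']
    [IsTopologicalAddGroup E'] [ContinuousSMul ℝ E'] [LocallyConvexSpace ℝ E']
    [NormedAddCommGroup F] [NormedSpace ℝ F] [FiniteDimensional ℝ F]
    {K : Set E} {K' : Set E'} (hK : IsCompact K) (hK' : IsCompact K') (Φ : E →ₗ[ℝ] E' →ₗ[ℝ] F)
    (hΦ : Continuous fun p : E × E' => Φ p.1 p.2) :
    convexHull ℝ (Set.image2 (fun x y => Φ x y) K K') ⊆
      convexHull ℝ (Set.image2 (fun x y => Φ x y) (K.extremePoints ℝ) (K'.extremePoints ℝ)) := by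
  have hS : IsCompact (Set.image2 (fun x y => Φ x y) K K') := by
    rw [← Set.image_prod]
    exact (hK.prod hK').image hΦ
  have h := (isCompact_convexHull_of_finiteDimensional hS).image_subset_convexHull_image_extremePoints
    (convex_convexHull ℝ _) (ContinuousLinearMap.id ℝ F)
  simp only [ContinuousLinearMap.coe_id', Set.image_id] at h
  refine h.trans (convexHull_mono fun e he => ?_)
  obtain ⟨x, hx, y, hy, hxy⟩ :=
    exists_extremePoints_of_mem_extremePoints_convexHull_image2 hK hK' Φ hΦ he
  exact ⟨x, hx, y, hy, hxy⟩

end KreinMilman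

section WeakDual

variable {𝕜 X Y : Type*} [RCLike 𝕜] [NormedAddCommGroup X] [NormedSpace 𝕜 X]
  [NormedAddCommGroup Y] [NormedSpace 𝕜 Y]

instance WeakDual.locallyConvexSpace_real : LocallyConvexSpace ℝ (WeakDual 𝕜 X) :=
  inferInstanceAs (LocallyConvexSpace ℝ (WeakBilin (topDualPairing 𝕜 X)))

/-- The bilinear map sending `ξ ∈ X**` and `y ∈ Y*` to the values `ξ (y ∘ b i)`, for a family
`b` of operators from `X` to `Y`. -/
noncomputable def doubleDualPairing {ι : Type*} (b : ι → X →L[𝕜] Y) :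
    WeakDual 𝕜 (StrongDual 𝕜 X) →ₗ[ℝ] StrongDual 𝕜 Y →ₗ[ℝ] ι → 𝕜 :=
  LinearMap.mk₂ ℝ (fun ξ y i => ξ (y ∘L b i))
    (fun _ _ _ => rfl) (fun _ _ _ => rfl)
    (fun ξ y z => by ext i; simp)
    (fun c ξ y => by
      ext i
      have h : (c • y) ∘L b i = (c : 𝕜) • (y ∘L b i) := by
        ext x
        simp [RCLike.real_smul_eq_coe_mul]
      simp [h, RCLike.real_smul_eq_coe_mul])

@[simp]
theorem doubleDualPairing_apply {ι : Type*} (b : ι → X →L[𝕜] Y)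
    (ξ : WeakDual 𝕜 (StrongDual 𝕜 X)) (y : StrongDual 𝕜 Y) (i : ι) :
    doubleDualPairing b ξ y i = ξ (y ∘L b i) := rfl

theorem continuous_doubleDualPairing [FiniteDimensional 𝕜 Y] {ι : Type*} (b : ι → X →L[𝕜] Y) :
    Continuous fun p : WeakDual 𝕜 (StrongDual 𝕜 X) × StrongDual 𝕜 Y =>
      doubleDualPairing b p.1 p.2 := by
  refine continuous_pi fun i => ?_
  let e := Module.finBasis 𝕜 (StrongDual 𝕜 Y)
  have hexp (p : WeakDual 𝕜 (StrongDual 𝕜 X) × StrongDual 𝕜 Y) :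
      doubleDualPairing b p.1 p.2 i = ∑ k, e.repr p.2 k * p.1 (e k ∘L b i) := by
    have h : p.2 ∘L b i = ∑ k, e.repr p.2 k • (e k ∘L b i) := by
      ext x
      simpa [-Module.Basis.sum_repr] using
        (congrArg (fun f : StrongDual 𝕜 Y => f (b i x)) (e.sum_repr p.2)).symm
    simp [h]
  simp_rw [hexp]
  refine continuous_finsetSum _ fun k _ => Continuous.mul ?_ ?_
  · exact (LinearMap.continuous_of_finiteDimensional (e.coord k)).comp continuous_snd
  · exact (WeakDual.eval_continuous _).comp continuous_fst

theorem mem_extremePoints_of_inclusionInDoubleDual {x : X}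
    (hx : StrongDual.toWeakDual (NormedSpace.inclusionInDoubleDual 𝕜 X x) ∈
      (WeakDual.toStrongDual ⁻¹'
        Metric.closedBall (0 : StrongDual 𝕜 (StrongDual 𝕜 X)) 1).extremePoints ℝ) :
    RealExtremePoint 𝕜 (Metric.closedBall (0 : X) 1) x := by
  let J := NormedSpace.inclusionInDoubleDualLi 𝕜 (E := X)
  have hmem (z : X) : StrongDual.toWeakDual (J z) ∈ (WeakDual.toStrongDual ⁻¹'
      Metric.closedBall (0 : StrongDual 𝕜 (StrongDual 𝕜 X)) 1) ↔
      z ∈ Metric.closedBall (0 : X) 1 := by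
    rw [mem_closedBall_zero_iff, ← J.norm_map z]
    exact mem_closedBall_zero_iff (a := J z)
  refine ⟨(hmem x).1 hx.1, fun y hy z hz t ht0 ht1 hxyz => ?_⟩
  obtain ⟨h₁, h₂⟩ := (mem_extremePoints.1 hx).2 _ ((hmem y).2 hy) _ ((hmem z).2 hz)
    ⟨t, 1 - t, ht0, sub_pos.2 ht1, by ring, by
      refine DFunLike.ext _ _ fun f => ?_
      change t • f y + (1 - t) • f z = f x
      rw [hxyz]
      simp [RCLike.real_smul_eq_coe_mul]⟩
  exact ⟨J.injective h₁, J.injective h₂⟩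

/-- In a reflexive space, the values of a finite family of operators at pairs of extreme points
of the unit balls contain in their convex hull every vector dominated by the operator norm. -/
theorem mem_convexHull_extremePoints_of_forall_re_le_norm [FiniteDimensional 𝕜 Y]
    (hrefl : Function.Surjective (NormedSpace.inclusionInDoubleDual 𝕜 X))
    {ι : Type*} [Fintype ι] (b : ι → X →L[𝕜] Y) (v : ι → 𝕜)
    (hv : ∀ β : ι → 𝕜, RCLike.re (∑ i, β i * v i) ≤ ‖∑ i, β i • b i‖) :
    v ∈ convexHull ℝ (Set.image2 (fun (x : X) (y : StrongDual 𝕜 Y) i => y (b i x))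
      {x | RealExtremePoint 𝕜 (Metric.closedBall (0 : X) 1) x}
      ((Metric.closedBall (0 : StrongDual 𝕜 Y) 1).extremePoints ℝ)) := by
  classical
  have : ProperSpace (StrongDual 𝕜 Y) := FiniteDimensional.proper 𝕜 _
  have hK := WeakDual.isCompact_closedBall (𝕜 := 𝕜) (0 : StrongDual 𝕜 (StrongDual 𝕜 X)) 1
  have hK' := isCompact_closedBall (0 : StrongDual 𝕜 Y) 1
  have hcont := continuous_doubleDualPairing b
  have hS := (hK.prod hK').image hcont
  rw [Set.image_prod (f := fun x y => doubleDualPairing b x y)] at hS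
  have hmem : v ∈ convexHull ℝ (Set.image2 (fun x y => doubleDualPairing b x y)
      (WeakDual.toStrongDual ⁻¹' Metric.closedBall (0 : StrongDual 𝕜 (StrongDual 𝕜 X)) 1)
      (Metric.closedBall (0 : StrongDual 𝕜 Y) 1)) := by
    by_contra hnot
    obtain ⟨g, u, hgu, hu⟩ := RCLike.geometric_hahn_banach_closed_point (𝕜 := 𝕜)
      (convex_convexHull ℝ _) (isCompact_convexHull_of_finiteDimensional hS).isClosed hnot
    have hg (c : ι → 𝕜) : g c = ∑ i, g (Pi.single i 1) * c i := by
      conv_lhs => rw [pi_eq_sum_univ' c]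
      simp [mul_comm]
    have hgS {ξ : StrongDual 𝕜 (StrongDual 𝕜 X)} {y : StrongDual 𝕜 Y} (hξ : ‖ξ‖ ≤ 1)
        (hy : ‖y‖ ≤ 1) :
        RCLike.re (g (doubleDualPairing b (StrongDual.toWeakDual ξ) y)) < u :=
      hgu _ (subset_convexHull ℝ _ ⟨_, mem_closedBall_zero_iff.2 hξ, y,
        mem_closedBall_zero_iff.2 hy, rfl⟩)
    have hu0 : 0 ≤ u := by
      simpa using (hgS (y := 0) ((NormedSpace.double_dual_bound 𝕜 X 0).trans (by simp))
        (by simp)).le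
    refine (hu.trans_le ((congrArg RCLike.re (hg v)).le.trans (hv _))).not_ge ?_
    refine ContinuousLinearMap.opNorm_le_of_unit_norm hu0 fun x hx => ?_
    obtain ⟨y, hy, hyx⟩ := exists_dual_vector'' 𝕜 ((∑ i, g (Pi.single i 1) • b i) x)
    have hlt := hgS (ξ := NormedSpace.inclusionInDoubleDual 𝕜 X x)
      ((NormedSpace.double_dual_bound 𝕜 X x).trans hx.le) hy
    rw [hg] at hlt
    have hre : ∑ i, g (Pi.single i 1) * doubleDualPairing b
        (StrongDual.toWeakDual (NormedSpace.inclusionInDoubleDual 𝕜 X x)) y i =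
        y ((∑ i, g (Pi.single i 1) • b i) x) := by
      simp
    rw [hre, hyx, RCLike.ofReal_re] at hlt
    exact hlt.le
  refine convexHull_mono ?_
    (convexHull_image2_subset_convexHull_image2_extremePoints hK hK' _ hcont hmem)
  rintro _ ⟨ξ, hξ, y, hy, rfl⟩
  obtain ⟨x, hx⟩ := hrefl (WeakDual.toStrongDual ξ)
  obtain rfl : ξ = StrongDual.toWeakDual (NormedSpace.inclusionInDoubleDual 𝕜 X x) := by
    rw [hx]; rfl
  exact ⟨x, mem_extremePoints_of_inclusionInDoubleDual hξ, y, hy, rfl⟩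

end WeakDual

section Orthogonality

variable {𝕜 X Y : Type*} [RCLike 𝕜] [NormedAddCommGroup X] [NormedSpace 𝕜 X]
  [NormedAddCommGroup Y] [NormedSpace 𝕜 Y]

theorem realExtremePoint_supportingFunctionals {f : StrongDual 𝕜 Y} {y : Y}
    (hf : f ∈ (Metric.closedBall (0 : StrongDual 𝕜 Y) 1).extremePoints ℝ)
    (hf1 : ‖f‖ = 1) (hfy : f y = ‖y‖) :
    RealExtremePoint 𝕜 {f : Y →L[𝕜] 𝕜 | ‖f‖ = 1 ∧ f y = (‖y‖ : 𝕜)} f := by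
  refine ⟨⟨hf1, hfy⟩, fun p hp q hq t ht0 ht1 h => ?_⟩
  refine (mem_extremePoints.1 hf).2 p (by simp [hp.1]) q (by simp [hq.1])
    ⟨t, 1 - t, ht0, sub_pos.2 ht1, by ring, ?_⟩
  ext z
  rw [h]
  simp [RCLike.real_smul_eq_coe_mul]

theorem norm_le_norm_add_of_sum_eq_zero {ι : Type*} [Fintype ι] {T A : X →L[𝕜] Y}
    {x : ι → X} {f : ι → StrongDual 𝕜 Y} {w : ι → ℝ} (hx : ∀ i, ‖x i‖ ≤ 1) (hf : ∀ i, ‖f i‖ ≤ 1)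
    (hfT : ∀ i, f i (T (x i)) = ‖T‖) (hw : ∀ i, 0 ≤ w i) (hw1 : ∑ i, w i = 1)
    (hA : ∑ i, (w i : 𝕜) * f i (A (x i)) = 0) (c : 𝕜) : ‖T‖ ≤ ‖T + c • A‖ := by
  have hsum : ∑ i, (w i : 𝕜) * f i ((T + c • A) (x i)) = ‖T‖ := by
    have h : ∑ i, (w i : 𝕜) * f i ((T + c • A) (x i)) =
        (∑ i, (w i : 𝕜)) * ‖T‖ + c * ∑ i, (w i : 𝕜) * f i (A (x i)) := by
      rw [Finset.sum_mul, Finset.mul_sum, ← Finset.sum_add_distrib]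
      refine Finset.sum_congr rfl fun i _ => ?_
      simp [hfT, mul_add, mul_left_comm]
    rw [h, hA, ← RCLike.ofReal_sum, hw1]
    simp
  calc ‖T‖ = ‖∑ i, (w i : 𝕜) * f i ((T + c • A) (x i))‖ := by
        rw [hsum, RCLike.norm_ofReal, abs_norm]
    _ ≤ ∑ i, w i * ‖T + c • A‖ := norm_sum_le_of_le _ fun i _ => by
      rw [norm_mul, RCLike.norm_of_nonneg (hw i)]
      gcongr
      · exact hw i
      · exact ((f i).le_of_opNorm_le_of_le (hf i)
          ((T + c • A).le_of_opNorm_le_of_le le_rfl (hx i))).trans (by simp)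
    _ = ‖T + c • A‖ := by rw [← Finset.sum_mul, hw1, one_mul]

theorem eq_one_of_sum_mul_eq_one {ι : Type*} [Fintype ι] {w : ι → ℝ} {z : ι → 𝕜}
    (hw : ∀ i, 0 < w i) (hw1 : ∑ i, w i = 1) (hz : ∀ i, ‖z i‖ ≤ 1)
    (h : ∑ i, (w i : 𝕜) * z i = 1) (i : ι) : z i = 1 := by
  have hre (i) : RCLike.re (z i) ≤ 1 := (RCLike.re_le_norm _).trans (hz i)
  have hsum : ∑ i, w i * RCLike.re (z i) = ∑ i, w i := by
    simpa [hw1] using congrArg RCLike.re h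
  have hi := (Finset.sum_eq_sum_iff_of_le fun i _ =>
    mul_le_of_le_one_right (hw i).le (hre i)).1 hsum i (Finset.mem_univ i)
  have hi1 : RCLike.re (z i) = 1 := by
    simpa using mul_left_cancel₀ (hw i).ne' (hi.trans (mul_one _).symm)
  rw [← RCLike.re_eq_self_of_le ((hz i).trans hi1.ge), hi1, RCLike.ofReal_one]

theorem mem_norming_of_apply_eq_one {T : X →L[𝕜] Y} (hT : ‖T‖ = 1) {x : X} (hx : ‖x‖ ≤ 1)
    {f : StrongDual 𝕜 Y} (hf : ‖f‖ ≤ 1) (h : f (T x) = 1) :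
    ‖x‖ = 1 ∧ ‖T x‖ = 1 ∧ ‖f‖ = 1 := by
  have h₁ : 1 ≤ ‖f‖ * ‖T x‖ := by simpa [h] using f.le_opNorm (T x)
  have h₂ : ‖T x‖ ≤ ‖x‖ := by simpa [hT] using T.le_opNorm x
  have h₃ : 1 ≤ ‖T x‖ := h₁.trans (mul_le_of_le_one_left (norm_nonneg _) hf)
  have h₄ : ‖T x‖ = 1 := le_antisymm (h₂.trans hx) h₃
  exact ⟨le_antisymm hx (h₃.trans h₂), h₄, le_antisymm hf (by simpa [h₄] using h₁)⟩

end Orthogonality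

/-- **Theorem (orthogonality to a finite-dimensional subspace).**
Let `X` be a reflexive Banach space, `Y` a finite-dimensional Banach space,
`T ∈ L(X,Y)` with `‖T‖ = 1` and `W` a finite-dimensional subspace of `L(X,Y)`.
Then `T ⊥_B W` iff there exist `h ≥ 1`, `x_i ∈ M_T ∩ Ext(B_X)`,
`y_i* ∈ Ext(J(T x_i))` and `λ_i > 0` with `∑ λ_i = 1` such that
`∑ λ_i y_i*(A x_i) = 0` for all `A ∈ W`. -/
theorem birkhoff_orthogonality_subspace_reflexive_finiteDim
    {𝕜 X Y : Type*} [RCLike 𝕜]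
    [NormedAddCommGroup X] [NormedSpace 𝕜 X] [CompleteSpace X]
    [NormedAddCommGroup Y] [NormedSpace 𝕜 Y] [CompleteSpace Y] [FiniteDimensional 𝕜 Y]
    (hrefl : Function.Surjective (NormedSpace.inclusionInDoubleDual 𝕜 X))
    (T : X →L[𝕜] Y) (hT : ‖T‖ = 1)
    (W : Submodule 𝕜 (X →L[𝕜] Y)) (hW : FiniteDimensional 𝕜 W) :
    (∀ A ∈ W, ∀ c : 𝕜, ‖T‖ ≤ ‖T + c • A‖) ↔
      ∃ (h : ℕ), 1 ≤ h ∧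
        ∃ (x : Fin h → X) (ystar : Fin h → (Y →L[𝕜] 𝕜)) (lam : Fin h → ℝ),
          (∀ i, ‖x i‖ = 1 ∧ ‖T (x i)‖ = ‖T‖ ∧
            RealExtremePoint 𝕜 (Metric.closedBall (0 : X) 1) (x i)) ∧
          (∀ i, RealExtremePoint 𝕜
            {f : Y →L[𝕜] 𝕜 | ‖f‖ = 1 ∧ f (T (x i)) = (‖T (x i)‖ : 𝕜)} (ystar i)) ∧
          (∀ i, 0 < lam i) ∧ (∑ i, lam i = 1) ∧
          (∀ A ∈ W, ∑ i, ((lam i : 𝕜)) * (ystar i) (A (x i)) = 0) := by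
  constructor
  · intro horth
    let e := Module.finBasis 𝕜 W
    let b : Option (Fin (Module.finrank 𝕜 W)) → X →L[𝕜] Y := fun o => o.elim T fun i => e i
    let v : Option (Fin (Module.finrank 𝕜 W)) → 𝕜 := fun o => o.elim 1 fun _ => 0
    have hv (β : Option (Fin (Module.finrank 𝕜 W)) → 𝕜) :
        RCLike.re (∑ i, β i * v i) ≤ ‖∑ i, β i • b i‖ := by
      simp only [Fintype.sum_option, v, b, Option.elim, mul_one, mul_zero, Finset.sum_const_zero,
        add_zero]
      rcases eq_or_ne (β none) 0 with h0 | h0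
      · simp [h0]
      · have hmem : ∑ i, β (some i) • (e i : X →L[𝕜] Y) ∈ W :=
          W.sum_mem fun i _ => W.smul_mem _ (e i).2
        have h := horth _ hmem (β none)⁻¹
        calc RCLike.re (β none) ≤ ‖β none‖ * ‖T‖ := by simpa [hT] using RCLike.re_le_norm (β none)
          _ ≤ ‖β none‖ * ‖T + (β none)⁻¹ • ∑ i, β (some i) • (e i : X →L[𝕜] Y)‖ := by gcongr
          _ = _ := by rw [← norm_smul, smul_add, smul_inv_smul₀ h0]
    have hmem := mem_convexHull_extremePoints_of_forall_re_le_norm hrefl b v hv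
    obtain ⟨κ, _, z, w, hz, -, hw, hw1, hsum⟩ := eq_pos_convex_span_of_mem_convexHull hmem
    choose x hx y hy hxy using fun k => hz ⟨k, rfl⟩
    have hx1 (k) : ‖x k‖ ≤ 1 := by simpa using (hx k).1
    have hy1 (k) : ‖y k‖ ≤ 1 := by simpa using (hy k).1
    have hcoord (o) : ∑ k, (w k : 𝕜) * y k (b o (x k)) = v o := by
      simpa [← hxy, RCLike.real_smul_eq_coe_mul] using congrFun hsum o
    have hone := eq_one_of_sum_mul_eq_one hw hw1 (z := fun k => y k (T (x k)))
      (fun k => ((y k).le_of_opNorm_le_of_le (hy1 k)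
        (T.le_of_opNorm_le_of_le hT.le (hx1 k))).trans (by simp)) (hcoord none)
    have hnorming (k) := mem_norming_of_apply_eq_one hT (hx1 k) (hy1 k) (hone k)
    have hzero (A) (hA : A ∈ W) : ∑ k, (w k : 𝕜) * y k (A (x k)) = 0 := by
      have hrepr : A = ∑ i, e.repr ⟨A, hA⟩ i • (e i : X →L[𝕜] Y) := by
        simpa [-Module.Basis.sum_repr] using (congrArg Subtype.val (e.sum_repr ⟨A, hA⟩)).symm
      rw [hrepr]
      simp only [sum_apply, smul_apply, map_sum, map_smul,
        smul_eq_mul, Finset.mul_sum]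
      rw [Finset.sum_comm]
      refine Finset.sum_eq_zero fun i _ => ?_
      simp_rw [mul_left_comm _ (e.repr ⟨A, hA⟩ i)]
      rw [← Finset.mul_sum]
      exact mul_eq_zero_of_right _ (hcoord (some i))
    have : Nonempty κ := by
      by_contra hκ
      rw [not_nonempty_iff] at hκ
      simp at hw1
    let s := (Fintype.equivFin κ).symm
    refine ⟨Fintype.card κ, Fintype.card_pos, x ∘ s, y ∘ s, w ∘ s, fun i => ?_, fun i => ?_,
      fun i => hw _, (s.sum_comp w).trans hw1, fun A hA => ?_⟩
    · exact ⟨(hnorming _).1, (hnorming _).2.1.trans hT.symm, hx _⟩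
    · refine realExtremePoint_supportingFunctionals (hy _) (hnorming _).2.2 ?_
      simpa [(hnorming _).2.1] using hone (s i)
    · exact (s.sum_comp fun k => (w k : 𝕜) * y k (A (x k))).trans (hzero A hA)
  · rintro ⟨h, -, x, f, w, hx, hf, hw, hw1, hzero⟩ A hA c
    exact norm_le_norm_add_of_sum_eq_zero (fun i => (hx i).1.le) (fun i => (hf i).1.1.le)
      (fun i => by rw [(hf i).1.2, (hx i).2.1]) (fun i => (hw i).le) hw1 (hzero A hA) c
end

section
/- Let X be a reflexive Banach space, Y a finite-dimensional smooth Banach space, T a bounded linear operator from X to Y with ‖T‖ = 1, and W a finite-dimensional linear subspace of L(X,Y). Then T ⊥_B W if and only if there exist a natural number h ≥ 1, vectors x_1,…,x_h ∈ M_T ∩ Ext(B_X), and scalars λ_1,…,λ_h > 0 with ∑_{i=1}^h λ_i = 1, such that ∑_{i=1}^h λ_i f_i(A x_i) = 0 for every A ∈ W, where for each i, f_i is the unique norm-one functional on Y satisfying f_i(T x_i) = ‖T x_i‖. -/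
/-- A convex set in a finite-dimensional space is weakly separated from every point outside it. -/
theorem Convex.exists_ne_zero_forall_le_of_notMem_s1 {V : Type*} [NormedAddCommGroup V]
    [NormedSpace ℝ V] [FiniteDimensional ℝ V] {C : Set V} (hC : Convex ℝ C) (hne : C.Nonempty)
    {p : V} (hp : p ∉ C) : ∃ l : V →L[ℝ] ℝ, l ≠ 0 ∧ ∀ c ∈ C, l c ≤ l p := by
  by_cases hint : (interior C).Nonempty
  · exact geometric_hahn_banach_of_nonempty_interior_point hC (fun h ↦ hp (interior_subset h)) hint
  rw [hC.interior_nonempty_iff_affineSpan_eq_top] at hint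
  obtain ⟨c₀, hc₀⟩ := hne
  have hdir : (affineSpan ℝ C).direction ≠ ⊤ := fun h ↦
    hint ((AffineSubspace.direction_eq_top_iff_of_nonempty
      ((affineSpan_nonempty ℝ).2 ⟨c₀, hc₀⟩)).1 h)
  obtain ⟨f, hf0, hf⟩ := Submodule.exists_le_ker_of_lt_top _ (lt_top_iff_ne_top.2 hdir)
  have hconst : ∀ c ∈ C, f c = f c₀ := fun c hc ↦ by
    have := hf (AffineSubspace.vsub_mem_direction (subset_affineSpan ℝ C hc)
      (subset_affineSpan ℝ C hc₀))
    simpa [sub_eq_zero] using this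
  have hf0' : LinearMap.toContinuousLinearMap f ≠ 0 := by simpa using hf0
  rcases le_total (f c₀) (f p) with h | h
  · exact ⟨LinearMap.toContinuousLinearMap f, hf0', fun c hc ↦ by simpa [hconst c hc] using h⟩
  · exact ⟨-LinearMap.toContinuousLinearMap f, by simpa using hf0,
      fun c hc ↦ by simpa [hconst c hc] using h⟩

/-- Every value of a continuous linear map into a finite-dimensional space on a compact convex set
is attained on the (not necessarily closed) convex hull of the extreme points. -/
theorem exists_mem_convexHull_extremePoints_map_eq {E : Type*} [AddCommGroup E] [Module ℝ E]
    [TopologicalSpace E] [T2Space E] [IsTopologicalAddGroup E] [ContinuousSMul ℝ E]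
    [LocallyConvexSpace ℝ E] {V : Type*} [NormedAddCommGroup V]
    [NormedSpace ℝ V] [FiniteDimensional ℝ V] (L : E →L[ℝ] V) {K : Set E} (hK : IsCompact K)
    (hKc : Convex ℝ K) {x : E} (hx : x ∈ K) :
    ∃ y ∈ convexHull ℝ (K.extremePoints ℝ), L y = L x := by
  induction hn : Module.finrank ℝ V using Nat.strong_induction_on generalizing V K with
  | _ n ih =>
  subst hn
  by_contra! hcon
  have hp : L x ∉ L '' convexHull ℝ (K.extremePoints ℝ) := by
    rintro ⟨y, hy, h⟩
    exact hcon y hy h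
  obtain ⟨l, hl0, hl⟩ := ((convex_convexHull ℝ (K.extremePoints ℝ)).linear_image
    (L : E →ₗ[ℝ] V)).exists_ne_zero_forall_le_of_notMem_s1
    (((hK.extremePoints_nonempty ⟨x, hx⟩).convexHull (𝕜 := ℝ)).image _) hp
  have hmax : ∀ z ∈ K, l (L z) ≤ l (L x) := by
    intro z hz
    rw [← closure_convexHull_extremePoints hK hKc] at hz
    exact closure_minimal (fun y hy ↦ hl _ ⟨y, hy, rfl⟩)
      (isClosed_le (l.comp L).continuous continuous_const) hz
  set F : Set E := {y ∈ K | ∀ z ∈ K, (l.comp L) z ≤ (l.comp L) y} with hF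
  have hexp : IsExposed ℝ K F := fun _ ↦ ⟨l.comp L, rfl⟩
  obtain ⟨v, hv⟩ : ∃ v, l v = 1 := by
    obtain ⟨w, hw⟩ : ∃ w, l w ≠ 0 := by
      by_contra! h
      exact hl0 (by ext w; simpa using h w)
    exact ⟨(l w)⁻¹ • w, by simp [hw]⟩
  let P : V →L[ℝ] l.ker :=
    (ContinuousLinearMap.id ℝ V - l.smulRight v).codRestrict l.ker (fun u ↦ by simp [hv])
  have hP : ∀ u, ((P u : l.ker) : V) = u - l u • v := fun u ↦ rfl
  have hlt : Module.finrank ℝ l.ker < Module.finrank ℝ V := by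
    refine Submodule.finrank_lt fun h ↦ hl0 ?_
    ext w
    have : w ∈ l.ker := h ▸ Submodule.mem_top
    simpa using this
  obtain ⟨y, hy, hyx⟩ := ih _ hlt (P.comp L) (hexp.isCompact hK) (hexp.convex hKc)
    (show x ∈ F from ⟨hx, hmax⟩) rfl
  refine hcon y (convexHull_mono hexp.isExtreme.extremePoints_subset_extremePoints hy) ?_
  have hyF : y ∈ F := convexHull_min extremePoints_subset (hexp.convex hKc) hy
  have hly : l (L y) = l (L x) := le_antisymm (hmax y hyF.1) (hyF.2 x hx)
  have := congrArg (Subtype.val) hyx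
  simp only [ContinuousLinearMap.comp_apply, hP, hly] at this
  simpa using this

/-- In finite dimension, the convex hull of a compact set is compact. -/
theorem IsCompact.convexHull_of_finiteDimensional {V : Type*} [NormedAddCommGroup V]
    [NormedSpace ℝ V] [FiniteDimensional ℝ V] {D : Set V} (hD : IsCompact D) :
    IsCompact (convexHull ℝ D) := by
  have heq : convexHull ℝ D = ⋃ k ∈ Finset.range (Module.finrank ℝ V + 2),
      (fun q : (Fin k → ℝ) × (Fin k → V) ↦ ∑ i, q.1 i • q.2 i) ''
        (stdSimplex ℝ (Fin k) ×ˢ Set.univ.pi fun _ ↦ D) := by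
    apply Set.Subset.antisymm
    · intro x hx
      obtain ⟨ι, _, z, w, hz, haff, hw, hw1, rfl⟩ := eq_pos_convex_span_of_mem_convexHull hx
      have hcard : Fintype.card ι ≤ Module.finrank ℝ V + 1 :=
        haff.card_le_finrank_succ.trans (Nat.succ_le_succ (Submodule.finrank_le _))
      let e := Fintype.equivFin ι
      refine Set.mem_biUnion (x := Fintype.card ι) (by simp; omega)
        ⟨(w ∘ e.symm, z ∘ e.symm), ⟨⟨fun i ↦ (hw _).le, ?_⟩, fun i _ ↦ hz ⟨_, rfl⟩⟩, ?_⟩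
      · rw [← hw1]; exact e.symm.sum_comp w
      · exact e.symm.sum_comp (fun i ↦ w i • z i)
    · refine Set.iUnion₂_subset fun k _ ↦ ?_
      rintro _ ⟨⟨w, z⟩, ⟨hw, hz⟩, rfl⟩
      exact mem_convexHull_of_exists_fintype w z hw.1 hw.2 (fun i ↦ hz i trivial) rfl
  rw [heq]
  refine Finset.isCompact_biUnion _ fun k _ ↦ ?_
  exact ((isCompact_stdSimplex ℝ _).prod (isCompact_univ_pi fun _ ↦ hD)).image (by fun_prop)

section Reflexive

variable {𝕜 X Y : Type*} [RCLike 𝕜] [NormedAddCommGroup X] [NormedSpace 𝕜 X]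
  [NormedAddCommGroup Y] [NormedSpace 𝕜 Y]

/-- The weak-star dual of a normed space is a locally convex real vector space. -/
theorem WeakDual.locallyConvexSpace_real_s1 (𝕜 Z : Type*) [RCLike 𝕜] [NormedAddCommGroup Z]
    [NormedSpace 𝕜 Z] : LocallyConvexSpace ℝ (WeakDual 𝕜 Z) :=
  WeakBilin.locallyConvexSpace

/-- In a dual ball, the joint values at finitely many vectors of a point of the slice `re (ξ g) = 1`
are attained on the convex hull of the extreme points of that slice. -/
theorem exists_mem_convexHull_extremePoints_weakDual {Z : Type*} [NormedAddCommGroup Z]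
    [NormedSpace 𝕜 Z] {ι : Type*} [Fintype ι] (φ : ι → Z) (g : Z) {ξ : WeakDual 𝕜 Z}
    (hξ : ξ ∈ WeakDual.toStrongDual ⁻¹' Metric.closedBall (0 : StrongDual 𝕜 Z) 1)
    (hξg : RCLike.re (ξ g) = 1) :
    ∃ y ∈ convexHull ℝ (((WeakDual.toStrongDual ⁻¹' Metric.closedBall (0 : StrongDual 𝕜 Z) 1) ∩
      {ξ : WeakDual 𝕜 Z | RCLike.re (ξ g) = 1}).extremePoints ℝ), ∀ i, y (φ i) = ξ (φ i) := by
  have := WeakDual.locallyConvexSpace_real_s1 𝕜 Z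
  let L : WeakDual 𝕜 Z →L[ℝ] (ι → 𝕜) :=
    { toFun := fun ξ i ↦ ξ (φ i)
      map_add' := fun _ _ ↦ rfl
      map_smul' := fun _ _ ↦ rfl
      cont := continuous_pi fun i ↦ WeakDual.eval_continuous (φ i) }
  have hconv : Convex ℝ ((WeakDual.toStrongDual ⁻¹' Metric.closedBall (0 : StrongDual 𝕜 Z) 1) ∩
      {ξ : WeakDual 𝕜 Z | RCLike.re (ξ g) = 1}) := by
    rintro ξ ⟨hξ, hξg⟩ η ⟨hη, hηg⟩ a b ha hb hab
    refine ⟨convex_closedBall (0 : StrongDual 𝕜 Z) 1 hξ hη ha hb hab, ?_⟩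
    rw [Set.mem_ofPred_eq] at *
    change RCLike.re (a • ξ g + b • η g) = 1
    rw [map_add, RCLike.smul_re, RCLike.smul_re, hξg, hηg]
    linarith
  obtain ⟨y, hy, hyx⟩ := exists_mem_convexHull_extremePoints_map_eq L
    ((WeakDual.isCompact_closedBall (0 : StrongDual 𝕜 Z) 1).inter_right
      (isClosed_eq (RCLike.continuous_re.comp (WeakDual.eval_continuous g)) continuous_const))
    hconv (x := ξ) ⟨hξ, hξg⟩
  exact ⟨y, hy, congrFun hyx⟩

/-- In a reflexive space, the joint values of finitely many functionals at a point of the unit ball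
where the contractive functional `g` is `1` are convex combinations of their joint values at
extreme points of the unit ball where `g` is `1`. -/
theorem mem_convexHull_extreme_of_reflexive
    (hrefl : Function.Surjective (NormedSpace.inclusionInDoubleDual 𝕜 X))
    {ι : Type*} [Fintype ι] (φ : ι → X →L[𝕜] 𝕜) (g : X →L[𝕜] 𝕜) (hg : ‖g‖ ≤ 1)
    {x : X} (hx : ‖x‖ ≤ 1) (hgx : g x = 1) :
    (fun i ↦ φ i x) ∈ convexHull ℝ {v : ι → 𝕜 | ∃ z : X,
      RealExtremePoint 𝕜 (Metric.closedBall (0 : X) 1) z ∧ g z = 1 ∧ v = fun i ↦ φ i z} := by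
  have hre : ∀ z : X, ‖z‖ ≤ 1 → RCLike.re (g z) ≤ 1 := fun z hz ↦
    (RCLike.re_le_norm _).trans ((g.le_of_opNorm_le_of_le hg hz).trans (by norm_num))
  have hg1 : ∀ z : X, ‖z‖ ≤ 1 → RCLike.re (g z) = 1 → g z = 1 := fun z hz h ↦ by
    have hn : ‖g z‖ ≤ 1 := (g.le_of_opNorm_le_of_le hg hz).trans (by norm_num)
    have := (RCLike.norm_le_re_iff_eq_norm (z := g z)).1 (hn.trans h.ge)
    have h2 : ‖g z‖ = 1 := le_antisymm hn (h.ge.trans (RCLike.re_le_norm _))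
    rw [this, h2]; simp
  let J : X → WeakDual 𝕜 (StrongDual 𝕜 X) := fun z ↦
    StrongDual.toWeakDual (NormedSpace.inclusionInDoubleDual 𝕜 X z)
  have hJ : ∀ z (f : StrongDual 𝕜 X), J z f = f z := fun z f ↦ rfl
  have hJinj : Function.Injective J := fun z w h ↦
    (NormedSpace.inclusionInDoubleDualLi 𝕜 (E := X)).injective
      (StrongDual.toWeakDual.injective h)
  have hJsurj : Function.Surjective J := StrongDual.toWeakDual.surjective.comp hrefl
  have hJball : ∀ z, J z ∈ WeakDual.toStrongDual ⁻¹' Metric.closedBall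
      (0 : StrongDual 𝕜 (StrongDual 𝕜 X)) 1 ↔ ‖z‖ ≤ 1 := fun z ↦ by
    refine (mem_closedBall_zero_iff (E := StrongDual 𝕜 (StrongDual 𝕜 X))).trans ?_
    exact (NormedSpace.inclusionInDoubleDualLi 𝕜 (E := X)).norm_map z ▸ Iff.rfl
  obtain ⟨y, hy, hyx⟩ := exists_mem_convexHull_extremePoints_weakDual φ g (ξ := J x)
    ((hJball x).2 hx) (by simp [hJ, hgx])
  let L : WeakDual 𝕜 (StrongDual 𝕜 X) →ₗ[ℝ] (ι → 𝕜) :=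
    { toFun := fun ξ i ↦ ξ (φ i)
      map_add' := fun _ _ ↦ rfl
      map_smul' := fun _ _ ↦ rfl }
  have hLy : L y = fun i ↦ φ i x := funext hyx
  rw [← hLy]
  refine convexHull_min (t := L ⁻¹' _) ?_ ((convex_convexHull ℝ _).linear_preimage _) hy
  intro ξ hξ
  rw [mem_extremePoints] at hξ
  obtain ⟨⟨hξb, hξg⟩, hext⟩ := hξ
  obtain ⟨z, rfl⟩ := hJsurj ξ
  refine subset_convexHull ℝ _ ⟨z, ⟨?_, ?_⟩, hg1 z ((hJball z).1 hξb) hξg, rfl⟩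
  · simpa using (hJball z).1 hξb
  intro u hu w hw t ht0 ht1 hz
  rw [mem_closedBall_zero_iff] at hu hw
  have hcomb : RCLike.re (g z) = t * RCLike.re (g u) + (1 - t) * RCLike.re (g w) := by
    rw [hz, map_add, map_smul, map_smul, smul_eq_mul, smul_eq_mul, map_add,
      RCLike.re_ofReal_mul, RCLike.re_ofReal_mul]
  have hz1 : RCLike.re (g z) = 1 := hξg
  have hu1 := hre u hu
  have hw1 := hre w hw
  have hu' : RCLike.re (g u) = 1 := by nlinarith
  have hw' : RCLike.re (g w) = 1 := by nlinarith
  obtain ⟨h1, h2⟩ := hext (J u) ⟨(hJball u).2 hu, hu'⟩ (J w) ⟨(hJball w).2 hw, hw'⟩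
    ⟨t, 1 - t, ht0, by linarith, by ring, by
      refine DFunLike.ext _ _ fun f ↦ ?_
      change t • f u + (1 - t) • f w = f z
      rw [hz, map_add, map_smul, map_smul, smul_eq_mul, smul_eq_mul, RCLike.real_smul_eq_coe_mul,
        RCLike.real_smul_eq_coe_mul]⟩
  exact ⟨hJinj h1, hJinj h2⟩

/-- For `X` reflexive and `Y` finite-dimensional, the joint values at finitely many operators of the
functionals `A ↦ f (A x)` with `‖f‖ ≤ 1`, `‖x‖ ≤ 1` form a compact set. -/
theorem isCompact_setOf_rank_one_values [FiniteDimensional 𝕜 Y]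
    (hrefl : Function.Surjective (NormedSpace.inclusionInDoubleDual 𝕜 X))
    {ι : Type*} [Fintype ι] (b : ι → X →L[𝕜] Y) :
    IsCompact {v : ι → 𝕜 | ∃ (f : Y →L[𝕜] 𝕜) (x : X),
      ‖f‖ ≤ 1 ∧ ‖x‖ ≤ 1 ∧ v = fun i ↦ f (b i x)} := by
  have : ProperSpace (Y →L[𝕜] 𝕜) := FiniteDimensional.proper 𝕜 _
  let e := Module.finBasis 𝕜 Y
  let c : Fin (Module.finrank 𝕜 Y) → Y →L[𝕜] 𝕜 := fun j ↦
    LinearMap.toContinuousLinearMap (e.coord j)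
  have hexp : ∀ (f : Y →L[𝕜] 𝕜) (y : Y), f y = ∑ j, f (e j) * c j y := fun f y ↦ by
    conv_lhs => rw [← e.sum_repr y, map_sum]
    simp [c, mul_comm]
  have hc : Continuous fun q : (Y →L[𝕜] 𝕜) × WeakDual 𝕜 (StrongDual 𝕜 X) ↦
      fun i ↦ ∑ j, q.1 (e j) * q.2 ((c j).comp (b i)) := by
    refine continuous_pi fun i ↦ continuous_finsetSum _ fun j _ ↦ Continuous.mul ?_ ?_
    · fun_prop
    · exact (WeakDual.eval_continuous _).comp continuous_snd
  convert ((isCompact_closedBall (0 : Y →L[𝕜] 𝕜) 1).prod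
    (WeakDual.isCompact_closedBall (0 : StrongDual 𝕜 (StrongDual 𝕜 X)) 1)).image hc using 1
  ext v
  constructor
  · rintro ⟨f, x, hf, hx, rfl⟩
    refine ⟨(f, StrongDual.toWeakDual (NormedSpace.inclusionInDoubleDual 𝕜 X x)),
      ⟨by simpa using hf, ?_⟩, ?_⟩
    · rw [Set.mem_preimage, mem_closedBall_zero_iff]
      exact ((NormedSpace.inclusionInDoubleDualLi 𝕜 (E := X)).norm_map x).le.trans hx
    · ext i
      rw [hexp]
      rfl
  · rintro ⟨⟨f, ξ⟩, ⟨hf, hξ⟩, rfl⟩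
    obtain ⟨x, hx⟩ := hrefl (WeakDual.toStrongDual ξ)
    refine ⟨f, x, by simpa using hf, ?_, ?_⟩
    · rw [Set.mem_preimage, mem_closedBall_zero_iff, ← hx] at hξ
      exact ((NormedSpace.inclusionInDoubleDualLi 𝕜 (E := X)).norm_map x).ge.trans hξ
    · ext i
      rw [hexp]
      refine Finset.sum_congr rfl fun j _ ↦ ?_
      exact congrArg (f (e j) * ·) (DFunLike.congr_fun hx ((c j).comp (b i))).symm

/-- The joint values of a contractive functional on `L(X,Y)` at finitely many operators are convex
combinations of the joint values of functionals `A ↦ f (A x)`, `‖f‖ ≤ 1`, `‖x‖ ≤ 1`. -/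
theorem mem_convexHull_rank_one_values [FiniteDimensional 𝕜 Y]
    (hrefl : Function.Surjective (NormedSpace.inclusionInDoubleDual 𝕜 X))
    {ι : Type*} [Fintype ι] (b : ι → X →L[𝕜] Y) (φ : (X →L[𝕜] Y) →L[𝕜] 𝕜) (hφ : ‖φ‖ ≤ 1) :
    (fun i ↦ φ (b i)) ∈ convexHull ℝ {v : ι → 𝕜 | ∃ (f : Y →L[𝕜] 𝕜) (x : X),
      ‖f‖ ≤ 1 ∧ ‖x‖ ≤ 1 ∧ v = fun i ↦ f (b i x)} := by
  classical
  by_contra hmem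
  obtain ⟨l, u, hl, hu⟩ := RCLike.geometric_hahn_banach_closed_point (𝕜 := 𝕜)
    (convex_convexHull ℝ _)
    (isCompact_setOf_rank_one_values hrefl b).convexHull_of_finiteDimensional.isClosed hmem
  set A : X →L[𝕜] Y := ∑ i, l (Pi.single i 1) • b i with hA
  have hlin : ∀ v : ι → 𝕜, l v = ∑ i, l (Pi.single i 1) * v i := fun v ↦ by
    conv_lhs => rw [pi_eq_sum_univ' v, map_sum]
    refine Finset.sum_congr rfl fun i _ ↦ ?_
    rw [map_smul, smul_eq_mul, mul_comm]
  have hφA : l (fun i ↦ φ (b i)) = φ A := by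
    rw [hlin, hA, map_sum]
    simp only [map_smul, smul_eq_mul]
  have hfA : ∀ (f : Y →L[𝕜] 𝕜) (x : X), l (fun i ↦ f (b i x)) = f (A x) := fun f x ↦ by
    rw [hlin, hA]
    simp
  have hbound : ∀ (f : Y →L[𝕜] 𝕜) (x : X), ‖f‖ ≤ 1 → ‖x‖ ≤ 1 → RCLike.re (f (A x)) < u :=
    fun f x hf hx ↦ hfA f x ▸ hl _ (subset_convexHull ℝ _ ⟨f, x, hf, hx, rfl⟩)
  have hu0 : 0 ≤ u := by simpa using (hbound 0 0 (by simp) (by simp)).le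
  have hAu : ‖A‖ ≤ u := by
    refine ContinuousLinearMap.opNorm_le_of_unit_norm hu0 fun x hx ↦ ?_
    obtain ⟨f, hf, hfx⟩ := exists_dual_vector'' 𝕜 (A x)
    simpa [hfx] using (hbound f x hf hx.le).le
  have : RCLike.re (φ A) ≤ ‖A‖ := (RCLike.re_le_norm _).trans
    ((φ.le_of_opNorm_le hφ A).trans (one_mul _).le)
  rw [hφA] at hu
  linarith

/-- A point of the convex hull of `D` maximizing a linear functional over `D` lies in the convex
hull of the maximizers in `D`. -/
theorem mem_convexHull_of_forall_le_map {V : Type*} [AddCommGroup V] [Module ℝ V] {D : Set V}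
    (l : V →ₗ[ℝ] ℝ) {p : V} (hp : p ∈ convexHull ℝ D) (hl : ∀ d ∈ D, l d ≤ l p) :
    p ∈ convexHull ℝ {d ∈ D | l d = l p} := by
  obtain ⟨ι, _, w, z, hw, hw1, hz, rfl⟩ := mem_convexHull_iff_exists_fintype.1 hp
  set p := ∑ i, w i • z i with hpdef
  have hsum : ∑ i, w i * (l p - l (z i)) = 0 := by
    have : l p = ∑ i, w i * l (z i) := by simp [hpdef]
    simp only [mul_sub, Finset.sum_sub_distrib, ← Finset.sum_mul, hw1, ← this]
    ring
  have hzero := (Finset.sum_eq_zero_iff_of_nonneg fun i _ ↦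
    mul_nonneg (hw i) (sub_nonneg.2 (hl _ (hz i)))).1 hsum
  have hmem : ∀ i, w i ≠ 0 → z i ∈ {d ∈ D | l d = l p} := fun i hi ↦
    ⟨hz i, (sub_eq_zero.1 ((mul_eq_zero.1 (hzero i (Finset.mem_univ i))).resolve_left hi)).symm⟩
  have hp' : p = ∑ i with w i ≠ 0, w i • z i :=
    (Finset.sum_filter_of_ne fun i _ h ↦ left_ne_zero_of_smul h).symm
  suffices ∑ i with w i ≠ 0, w i • z i ∈ convexHull ℝ {d ∈ D | l d = l p} by rwa [← hp'] at this
  refine (convex_convexHull ℝ _).sum_mem (fun i _ ↦ hw i) ?_ fun i hi ↦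
    subset_convexHull ℝ _ (hmem i (Finset.mem_filter.1 hi).2)
  rw [Finset.sum_filter_ne_zero, hw1]

/-- If a contractive functional `φ` on `L(X,Y)` takes the value `1` at the contraction `T`, its joint
values at finitely many operators are convex combinations of those of functionals `A ↦ f (A x)` with
`x` an extreme point of the unit ball, `‖f‖ ≤ 1` and `f (T x) = 1`. -/
theorem mem_convexHull_extreme_rank_one_values [FiniteDimensional 𝕜 Y]
    (hrefl : Function.Surjective (NormedSpace.inclusionInDoubleDual 𝕜 X))
    {ι : Type*} [Fintype ι] (b : ι → X →L[𝕜] Y) (φ : (X →L[𝕜] Y) →L[𝕜] 𝕜) (hφ : ‖φ‖ ≤ 1)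
    (T : X →L[𝕜] Y) (hT : ‖T‖ ≤ 1) (hφT : φ T = 1) :
    (fun i ↦ φ (b i)) ∈ convexHull ℝ {v : ι → 𝕜 | ∃ (f : Y →L[𝕜] 𝕜) (x : X), ‖f‖ ≤ 1 ∧
      RealExtremePoint 𝕜 (Metric.closedBall (0 : X) 1) x ∧ f (T x) = 1 ∧
      v = fun i ↦ f (b i x)} := by
  let b' : Option ι → X →L[𝕜] Y := fun o ↦ o.elim T b
  let l : (Option ι → 𝕜) →ₗ[ℝ] ℝ := RCLike.reLm ∘ₗ LinearMap.proj none
  have hl : ∀ v, l v = RCLike.re (v none) := fun v ↦ rfl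
  have hnorm : ∀ (f : Y →L[𝕜] 𝕜) (x : X), ‖f‖ ≤ 1 → ‖x‖ ≤ 1 → ‖f (T x)‖ ≤ 1 := fun f x hf hx ↦
    (f.le_of_opNorm_le_of_le hf (T.le_of_opNorm_le_of_le hT hx)).trans (by norm_num)
  have hp1 : l (fun o ↦ φ (b' o)) = 1 := by
    change RCLike.re (φ T) = 1
    simp [hφT]
  have hmem := mem_convexHull_of_forall_le_map l (mem_convexHull_rank_one_values hrefl b' φ hφ) (by
    rintro _ ⟨f, x, hf, hx, rfl⟩
    rw [hp1]
    exact (RCLike.re_le_norm _).trans (hnorm f x hf hx))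
  let π : (Option ι → 𝕜) →ₗ[ℝ] (ι → 𝕜) := LinearMap.funLeft ℝ 𝕜 some
  refine convexHull_min (t := π ⁻¹' _) ?_ ((convex_convexHull ℝ _).linear_preimage π) hmem
  rintro _ ⟨⟨f, x, hf, hx, rfl⟩, hfx⟩
  rw [hp1] at hfx
  have hre : RCLike.re (f (T x)) = 1 := hfx
  have hfT : (f.comp T) x = 1 := by
    have h1 := hnorm f x hf hx
    have h2 := (RCLike.norm_le_re_iff_eq_norm (z := f (T x))).1 (h1.trans hre.ge)
    have h3 : ‖f (T x)‖ = 1 := le_antisymm h1 (hre.ge.trans (RCLike.re_le_norm _))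
    change f (T x) = 1
    rw [h2, h3]
    simp
  have hfTnorm : ‖f.comp T‖ ≤ 1 :=
    (f.opNorm_comp_le T).trans (mul_le_one₀ hf (norm_nonneg _) hT)
  refine convexHull_mono ?_
    (mem_convexHull_extreme_of_reflexive hrefl (fun i ↦ f.comp (b i)) (f.comp T) hfTnorm hx hfT)
  rintro _ ⟨z, hz, hfz, rfl⟩
  exact ⟨f, z, hf, hz, hfz, rfl⟩

end Reflexive

/-- A norm-one vector Birkhoff–James orthogonal to a closed subspace is normed by a contractive
functional vanishing on the subspace. -/
theorem exists_dual_eq_one_of_forall_le_norm_add {𝕜 E : Type*} [RCLike 𝕜] [NormedAddCommGroup E]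
    [NormedSpace 𝕜 E] (W : Submodule 𝕜 E) (hW : IsClosed (W : Set E)) {T : E} (hT : ‖T‖ = 1)
    (h : ∀ A ∈ W, ‖T‖ ≤ ‖T + A‖) :
    ∃ φ : E →L[𝕜] 𝕜, ‖φ‖ ≤ 1 ∧ φ T = 1 ∧ ∀ A ∈ W, φ A = 0 := by
  have := hW
  have hq : ‖W.mkQL T‖ = 1 := by
    refine le_antisymm ((Submodule.Quotient.norm_mk_le W T).trans hT.le) ?_
    refine QuotientAddGroup.le_norm_iff.2 fun m hm ↦ ?_
    have hmem : m - T ∈ W := (Submodule.Quotient.eq W).1 hm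
    simpa [hT] using h _ hmem
  obtain ⟨g, hg, hgT⟩ := exists_dual_vector'' 𝕜 (W.mkQL T)
  refine ⟨g.comp W.mkQL, ContinuousLinearMap.opNorm_le_bound _ zero_le_one fun A ↦ ?_, ?_, ?_⟩
  · exact g.le_of_opNorm_le_of_le hg (Submodule.Quotient.norm_mk_le W A)
  · simp only [ContinuousLinearMap.comp_apply, hgT, hq]
    simp
  · intro A hA
    have : W.mkQL A = 0 := (Submodule.Quotient.mk_eq_zero W).2 hA
    rw [ContinuousLinearMap.comp_apply, this, map_zero]

/-- **Corollary (smooth range space).**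
Let `X` be a reflexive Banach space, `Y` a finite-dimensional smooth Banach space,
`T ∈ L(X,Y)` with `‖T‖ = 1` and `W` a finite-dimensional subspace of `L(X,Y)`.
Then `T ⊥_B W` iff there exist `h ≥ 1`, `x_i ∈ M_T ∩ Ext(B_X)` and `λ_i > 0` with
`∑ λ_i = 1` such that `∑ λ_i f_i(A x_i) = 0` for all `A ∈ W`, where `f_i` is the
unique norm-one functional with `f_i (T x_i) = ‖T x_i‖`. -/
theorem birkhoff_orthogonality_subspace_smooth_range
    {𝕜 X Y : Type*} [RCLike 𝕜]
    [NormedAddCommGroup X] [NormedSpace 𝕜 X] [CompleteSpace X]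
    [NormedAddCommGroup Y] [NormedSpace 𝕜 Y] [CompleteSpace Y] [FiniteDimensional 𝕜 Y]
    (hrefl : Function.Surjective (NormedSpace.inclusionInDoubleDual 𝕜 X))
    (hsmooth : ∀ y : Y, ‖y‖ = 1 → ∃! f : Y →L[𝕜] 𝕜, ‖f‖ = 1 ∧ f y = (‖y‖ : 𝕜))
    (T : X →L[𝕜] Y) (hT : ‖T‖ = 1)
    (W : Submodule 𝕜 (X →L[𝕜] Y)) (hW : FiniteDimensional 𝕜 W) :
    (∀ A ∈ W, ∀ c : 𝕜, ‖T‖ ≤ ‖T + c • A‖) ↔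
      ∃ (h : ℕ), 1 ≤ h ∧
        ∃ (x : Fin h → X) (f : Fin h → (Y →L[𝕜] 𝕜)) (lam : Fin h → ℝ),
          (∀ i, ‖x i‖ = 1 ∧ ‖T (x i)‖ = ‖T‖ ∧
            RealExtremePoint 𝕜 (Metric.closedBall (0 : X) 1) (x i)) ∧
          (∀ i, ‖f i‖ = 1 ∧ (f i) (T (x i)) = (‖T (x i)‖ : 𝕜)) ∧
          (∀ i, 0 < lam i) ∧ (∑ i, lam i = 1) ∧
          (∀ A ∈ W, ∑ i, ((lam i : 𝕜)) * (f i) (A (x i)) = 0) := by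
  constructor
  · intro hBJ
    obtain ⟨φ, hφ, hφT, hφW⟩ := exists_dual_eq_one_of_forall_le_norm_add W
      W.closed_of_finiteDimensional hT fun A hA ↦ by simpa using hBJ A hA 1
    obtain ⟨S, hS⟩ := (Module.Finite.iff_fg.1 hW : W.FG)
    have hmem := mem_convexHull_extreme_rank_one_values hrefl
      (fun A : S ↦ (A : X →L[𝕜] Y)) φ hφ T hT.le hφT
    obtain ⟨ι, _, z, w, hz, -, hw, hw1, hsum⟩ := eq_pos_convex_span_of_mem_convexHull hmem
    choose f x hf hx hfx hfz using fun i ↦ hz ⟨i, rfl⟩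
    have hxle : ∀ i, ‖x i‖ ≤ 1 := fun i ↦ by simpa using (hx i).1
    have hTxle : ∀ i, ‖T (x i)‖ ≤ ‖x i‖ := fun i ↦ by
      simpa [hT] using T.le_opNorm (x i)
    have hmul : ∀ i, 1 ≤ ‖f i‖ * ‖T (x i)‖ := fun i ↦ by
      simpa [hfx i] using (f i).le_opNorm (T (x i))
    have hTx : ∀ i, ‖T (x i)‖ = 1 := fun i ↦ le_antisymm ((hTxle i).trans (hxle i)) <| by
      nlinarith [hmul i, hf i, norm_nonneg (T (x i))]
    let e := Fintype.equivFin ι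
    refine ⟨Fintype.card ι, ?_, x ∘ e.symm, f ∘ e.symm, w ∘ e.symm, fun i ↦ ⟨?_, ?_, hx _⟩,
      fun i ↦ ⟨?_, ?_⟩, fun i ↦ hw _, ?_, ?_⟩
    · rw [Nat.one_le_iff_ne_zero, Ne, Fintype.card_eq_zero_iff]
      intro _
      simp at hw1
    · exact le_antisymm (hxle _) ((hTx _).ge.trans (hTxle _))
    · rw [hT]
      exact hTx _
    · refine le_antisymm (hf _) ?_
      simpa [hTx] using hmul (e.symm i)
    · simp [hfx, hTx]
    · rw [← hw1]
      exact e.symm.sum_comp w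
    · let Λ : (X →L[𝕜] Y) →ₗ[𝕜] 𝕜 :=
        { toFun := fun A ↦ ∑ i, (w i : 𝕜) * f i (A (x i))
          map_add' := fun A B ↦ by simp [mul_add, Finset.sum_add_distrib]
          map_smul' := fun c A ↦ by simp [Finset.mul_sum, mul_left_comm] }
      have hΛ : W ≤ Λ.ker := by
        rw [← hS, Submodule.span_le]
        intro A hA
        have hval := congrFun hsum ⟨A, hA⟩
        rw [hφW A (hS ▸ Submodule.subset_span hA)] at hval
        rw [SetLike.mem_coe, LinearMap.mem_ker, ← hval, Finset.sum_apply]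
        refine Finset.sum_congr rfl fun i _ ↦ ?_
        rw [Pi.smul_apply, RCLike.real_smul_eq_coe_mul, hfz i]
      intro A hA
      rw [← show Λ A = 0 from hΛ hA]
      exact e.symm.sum_comp fun i ↦ (w i : 𝕜) * f i (A (x i))
  · rintro ⟨h, -, x, f, lam, hx, hf, hlam, hlam1, hsum⟩ A hA c
    have hval : ∑ i, (lam i : 𝕜) * f i ((T + c • A) (x i)) = 1 := by
      have h1 : ∑ i, (lam i : 𝕜) * f i (T (x i)) = 1 := by
        simp only [(hf _).2, (hx _).2.1, hT, RCLike.ofReal_one, mul_one]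
        rw [← RCLike.ofReal_sum, hlam1, RCLike.ofReal_one]
      have h2 : ∑ i, (lam i : 𝕜) * (c * f i (A (x i))) = c * 0 := by
        rw [← hsum A hA, Finset.mul_sum]
        exact Finset.sum_congr rfl fun i _ ↦ by ring
      simp [mul_add, Finset.sum_add_distrib, h1, h2]
    have hterm : ∀ i, ‖(lam i : 𝕜) * f i ((T + c • A) (x i))‖ ≤ lam i * ‖T + c • A‖ := fun i ↦ by
      rw [norm_mul, RCLike.norm_ofReal, abs_of_pos (hlam i)]
      refine mul_le_mul_of_nonneg_left ?_ (hlam i).le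
      simpa using (f i).le_of_opNorm_le_of_le (hf i).1.le
        ((T + c • A).le_of_opNorm_le_of_le le_rfl (hx i).1.le)
    calc ‖T‖ = ‖∑ i, (lam i : 𝕜) * f i ((T + c • A) (x i))‖ := by rw [hval, hT, norm_one]
      _ ≤ ∑ i, lam i * ‖T + c • A‖ := norm_sum_le_of_le _ fun i _ ↦ hterm i
      _ = ‖T + c • A‖ := by rw [← Finset.sum_mul, hlam1, one_mul]
end

section
/- Let W be a linear subspace of M_n(K) (K = ℝ or ℂ) and let T ∈ M_n(K) with operator norm ‖T‖ = 1 (as an operator on K^n with the Euclidean norm). Then T ⊥_B W if and only if there exists a density matrix P ∈ M_n(K) (a positive semidefinite matrix with trace 1) such that T*T P = P and tr((TP)* A) = 0 for all A ∈ W. -/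
open Matrix
open scoped ComplexOrder InnerProductSpace

/-- If `‖L‖ = 1` and no real perturbation `L + t • S` decreases the norm, then some unit
vector at which `L` attains its norm satisfies `0 ≤ Re ⟪L x, S x⟫`. -/
theorem ContinuousLinearMap.exists_norm_apply_eq_one_of_one_le_norm_add_smul
    {𝕜 E F : Type*} [RCLike 𝕜] [NormedAddCommGroup E] [InnerProductSpace 𝕜 E] [ProperSpace E]
    [NormedAddCommGroup F] [InnerProductSpace 𝕜 F] (L S : E →L[𝕜] F) (hL : ‖L‖ = 1)
    (h : ∀ t : ℝ, 1 ≤ ‖L + (t : 𝕜) • S‖) :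
    ∃ x, ‖x‖ = 1 ∧ ‖L x‖ = 1 ∧ 0 ≤ RCLike.re ⟪L x, S x⟫_𝕜 := by
  have approx (t : ℝ) (ht : 0 < t) (ht1 : t ≤ 1) : ∃ x, ‖x‖ = 1 ∧
      1 - t ^ 2 - t * ‖S‖ ≤ ‖L x‖ ∧ -(t * (1 + ‖S‖ ^ 2 / 2)) ≤ RCLike.re ⟪L x, S x⟫_𝕜 := by
    obtain ⟨x, hx, hlt⟩ : ∃ x, ‖x‖ = 1 ∧ 1 - t ^ 2 < ‖(L + (t : 𝕜) • S) x‖ := by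
      by_contra! H
      have := ContinuousLinearMap.opNorm_le_of_unit_norm (by nlinarith) H
      nlinarith [h t]
    have hSx : ‖S x‖ ≤ ‖S‖ := by simpa [hx] using S.le_opNorm x
    have hLx : ‖L x‖ ≤ 1 := by simpa [hx, hL] using L.le_opNorm x
    have hdef : (L + (t : 𝕜) • S) x = L x + (t : 𝕜) • S x := by simp
    rw [hdef] at hlt
    have hn : ‖(t : 𝕜) • S x‖ = t * ‖S x‖ := by
      rw [norm_smul, RCLike.norm_ofReal, abs_of_pos ht]
    refine ⟨x, hx, ?_, ?_⟩
    · have := norm_add_le (L x) ((t : 𝕜) • S x)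
      nlinarith
    · have hsq := norm_add_sq (𝕜 := 𝕜) (L x) ((t : 𝕜) • S x)
      rw [hn, inner_smul_right, RCLike.re_ofReal_mul] at hsq
      have h1 : (1 - t ^ 2) ^ 2 ≤ ‖L x + (t : 𝕜) • S x‖ ^ 2 :=
        pow_le_pow_left₀ (by nlinarith) hlt.le 2
      have h2 : ‖L x‖ ^ 2 ≤ 1 := pow_le_one₀ (norm_nonneg _) hLx
      have h3 : (t * ‖S x‖) ^ 2 ≤ t ^ 2 * ‖S‖ ^ 2 := by
        rw [mul_pow]
        gcongr
      have h4 : 0 ≤ 2 * t * (RCLike.re ⟪L x, S x⟫_𝕜 + t * (1 + ‖S‖ ^ 2 / 2)) := by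
        nlinarith [sq_nonneg (t ^ 2)]
      have := nonneg_of_mul_nonneg_right h4 (by positivity)
      linarith
  choose x hx hLx hre using fun k : ℕ ↦
    approx (1 / ((k : ℝ) + 1)) (by positivity)
      (by rw [div_le_one (by positivity)]; linarith [k.cast_nonneg (α := ℝ)])
  obtain ⟨y, hy, φ, hφ, hlim⟩ := (isCompact_sphere (0 : E) 1).tendsto_subseq
    (fun k ↦ mem_sphere_zero_iff_norm.2 (hx k))
  have hy : ‖y‖ = 1 := mem_sphere_zero_iff_norm.1 hy
  have ht : Filter.Tendsto (fun k ↦ 1 / ((φ k : ℝ) + 1)) Filter.atTop (nhds 0) :=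
    (tendsto_one_div_add_atTop_nhds_zero_nat (𝕜 := ℝ)).comp hφ.tendsto_atTop
  have hLlim := (L.continuous.tendsto y).comp hlim
  have hSlim := (S.continuous.tendsto y).comp hlim
  refine ⟨y, hy, le_antisymm (by simpa [hy, hL] using L.le_opNorm y) ?_, ?_⟩
  · have := le_of_tendsto_of_tendsto' ((tendsto_const_nhds.sub (ht.pow 2)).sub
      (ht.mul_const ‖S‖)) hLlim.norm (fun k ↦ hLx (φ k))
    simpa using this
  · have := le_of_tendsto_of_tendsto' (ht.mul_const (1 + ‖S‖ ^ 2 / 2)).neg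
      ((RCLike.continuous_re.tendsto _).comp (hLlim.inner (𝕜 := 𝕜) hSlim)) (fun k ↦ hre (φ k))
    simpa using this

/-- A contraction satisfies `L† (L x) = x` at every unit vector where it attains norm one. -/
theorem ContinuousLinearMap.adjoint_apply_apply_eq_self_of_norm_le_one
    {𝕜 E F : Type*} [RCLike 𝕜] [NormedAddCommGroup E] [InnerProductSpace 𝕜 E] [CompleteSpace E]
    [NormedAddCommGroup F] [InnerProductSpace 𝕜 F] [CompleteSpace F] (L : E →L[𝕜] F)
    (hL : ‖L‖ ≤ 1) {x : E} (hx : ‖L x‖ = ‖x‖) : L.adjoint (L x) = x := by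
  rw [← sub_eq_zero, ← norm_eq_zero, ← sq_nonpos_iff]
  have h1 : ‖L.adjoint (L x)‖ ≤ ‖x‖ := by
    refine (L.adjoint.le_opNorm _).trans ?_
    rw [LinearIsometryEquiv.norm_map, hx]
    exact mul_le_of_le_one_left (norm_nonneg _) hL
  rw [norm_sub_sq (𝕜 := 𝕜), ContinuousLinearMap.adjoint_inner_left, inner_self_eq_norm_sq, hx]
  nlinarith [norm_nonneg (L.adjoint (L x))]

namespace Matrix

variable {𝕜 n : Type*} [RCLike 𝕜] [Fintype n]

theorem trace_conjTranspose_mul_vecMulVec_star_mul [DecidableEq n] (T A : Matrix n n 𝕜) (v : n → 𝕜) :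
    ((T * vecMulVec v (star v))ᴴ * A).trace =
      ⟪toEuclideanCLM (𝕜 := 𝕜) T (WithLp.toLp 2 v),
        toEuclideanCLM (𝕜 := 𝕜) A (WithLp.toLp 2 v)⟫_𝕜 := by
  rw [toEuclideanCLM_toLp, toEuclideanCLM_toLp, EuclideanSpace.inner_toLp_toLp, mul_vecMulVec,
    conjTranspose_vecMulVec, star_star, vecMulVec_mul, trace_vecMulVec, dotProduct_comm,
    dotProduct_comm (A *ᵥ v), dotProduct_mulVec]

theorem trace_vecMulVec_star_self (v : n → 𝕜) :
    (vecMulVec v (star v)).trace = ((‖WithLp.toLp 2 v‖ ^ 2 : ℝ) : 𝕜) := by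
  rw [trace_vecMulVec, ← EuclideanSpace.inner_toLp_toLp, inner_self_eq_norm_sq_to_K]
  norm_cast

/-- Duality between the operator norm and the trace against a positive semidefinite matrix. -/
theorem PosSemidef.norm_trace_conjTranspose_mul_le [DecidableEq n] {P : Matrix n n 𝕜}
    (hP : P.PosSemidef) (htr : P.trace = 1) (T B : Matrix n n 𝕜) :
    ‖((T * P)ᴴ * B).trace‖ ≤ ‖toEuclideanCLM (𝕜 := 𝕜) T‖ * ‖toEuclideanCLM (𝕜 := 𝕜) B‖ := by
  obtain ⟨m, v, rfl⟩ := posSemidef_iff_eq_sum_vecMulVec.1 hP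
  have hsum : ∑ i, ‖WithLp.toLp 2 (v i)‖ ^ 2 = (1 : ℝ) := by
    simp_rw [trace_sum, trace_vecMulVec_star_self] at htr
    exact_mod_cast htr
  simp_rw [Matrix.mul_sum, conjTranspose_sum, Matrix.sum_mul, trace_sum,
    trace_conjTranspose_mul_vecMulVec_star_mul]
  rw [← mul_one (_ * _), ← hsum, Finset.mul_sum]
  refine (norm_sum_le _ _).trans (Finset.sum_le_sum fun i _ ↦ (norm_inner_le_norm _ _).trans ?_)
  calc _ ≤ (‖toEuclideanCLM (𝕜 := 𝕜) T‖ * ‖WithLp.toLp 2 (v i)‖) *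
        (‖toEuclideanCLM (𝕜 := 𝕜) B‖ * ‖WithLp.toLp 2 (v i)‖) := by
        gcongr <;> exact ContinuousLinearMap.le_opNorm _ _
    _ = _ := by ring

/-- The density matrices `P` with `Tᴴ * T * P = P`, i.e. those supported on the unit vectors at
which a contraction `T` attains norm one. -/
def normAttainingDensity (T : Matrix n n 𝕜) : Set (Matrix n n 𝕜) :=
  {P | P.PosSemidef ∧ P.trace = 1 ∧ Tᴴ * T * P = P}

theorem convex_normAttainingDensity (T : Matrix n n 𝕜) : Convex ℝ (normAttainingDensity T) := by
  rintro P ⟨hP, hPt, hPT⟩ Q ⟨hQ, hQt, hQT⟩ s t hs ht hst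
  refine ⟨(hP.smul hs).add (hQ.smul ht), ?_, ?_⟩
  · rw [trace_add, trace_smul, trace_smul, hPt, hQt, ← add_smul, hst, one_smul]
  · rw [Matrix.mul_add, Matrix.mul_smul, Matrix.mul_smul, hPT, hQT]

theorem isClosed_setOf_posSemidef : IsClosed {P : Matrix n n 𝕜 | P.PosSemidef} := by
  simp_rw [posSemidef_iff_dotProduct_mulVec, Set.ofPred_and, Set.ofPred_forall]
  exact (isClosed_eq (by fun_prop) continuous_id).inter
    (isClosed_iInter fun x ↦ isClosed_le continuous_const (by fun_prop))

theorem isCompact_normAttainingDensity [DecidableEq n] (T : Matrix n n 𝕜) :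
    IsCompact (normAttainingDensity T) := by
  let r (i j : n) : ℝ := ‖toEuclideanCLM (𝕜 := 𝕜) (1 : Matrix n n 𝕜)‖ *
    ‖toEuclideanCLM (𝕜 := 𝕜) (single i j (1 : 𝕜))‖
  have hK : IsCompact (Set.univ.pi fun i ↦ Set.univ.pi fun j ↦
      Metric.closedBall (0 : 𝕜) (r i j) : Set (Matrix n n 𝕜)) :=
    isCompact_univ_pi fun i ↦ isCompact_univ_pi fun j ↦ isCompact_closedBall _ _
  have entry_le (P : Matrix n n 𝕜) (hP : P ∈ normAttainingDensity T) (i j : n) :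
      ‖P i j‖ ≤ r i j := by
    have := hP.1.norm_trace_conjTranspose_mul_le hP.2.1 1 (single i j 1)
    rw [Matrix.one_mul, trace_mul_single] at this
    simpa [r] using this
  refine hK.of_isClosed_subset ?_ ?_
  · exact isClosed_setOf_posSemidef.inter ((isClosed_eq (by fun_prop) continuous_const).inter
      (isClosed_eq (by fun_prop) continuous_id))
  · rintro P hP i - j -
    exact mem_closedBall_zero_iff.2 (entry_le P hP i j)

theorem vecMulVec_star_mem_normAttainingDensity [DecidableEq n] {T : Matrix n n 𝕜}
    (hT : ‖toEuclideanCLM (𝕜 := 𝕜) T‖ ≤ 1) {x : EuclideanSpace 𝕜 n} (hx : ‖x‖ = 1)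
    (hTx : ‖toEuclideanCLM (𝕜 := 𝕜) T x‖ = 1) :
    vecMulVec x.ofLp (star x.ofLp) ∈ normAttainingDensity T := by
  have hfix := ContinuousLinearMap.adjoint_apply_apply_eq_self_of_norm_le_one _ hT
    (hTx.trans hx.symm)
  rw [← ContinuousLinearMap.star_eq_adjoint, ← map_star, ← mul_apply_eq_comp,
    ← map_mul, star_eq_conjTranspose] at hfix
  replace hfix : (Tᴴ * T) *ᵥ x.ofLp = x.ofLp := congrArg WithLp.ofLp hfix
  refine ⟨posSemidef_vecMulVec_self_star _, ?_, ?_⟩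
  · rw [trace_vecMulVec_star_self, WithLp.toLp_ofLp, hx]
    simp
  · rw [mul_vecMulVec, hfix]

end Matrix

/-- **Corollary (Grover's theorem for matrices).**
Let `W` be a subspace of `M_n(K)` and `T ∈ M_n(K)` with operator norm `‖T‖ = 1`.
Then `T ⊥_B W` iff there exists a density matrix `P` (positive semidefinite with
trace `1`) such that `T*T P = P` and `tr((TP)* A) = 0` for all `A ∈ W`. -/
theorem birkhoff_orthogonality_subspace_matrix
    {𝕜 : Type*} [RCLike 𝕜] {n : ℕ}
    (T : Matrix (Fin n) (Fin n) 𝕜)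
    (hT : ‖Matrix.toEuclideanCLM (𝕜 := 𝕜) T‖ = 1)
    (W : Submodule 𝕜 (Matrix (Fin n) (Fin n) 𝕜)) :
    (∀ A ∈ W, ∀ c : 𝕜,
        ‖Matrix.toEuclideanCLM (𝕜 := 𝕜) T‖ ≤ ‖Matrix.toEuclideanCLM (𝕜 := 𝕜) (T + c • A)‖) ↔
      ∃ P : Matrix (Fin n) (Fin n) 𝕜, P.PosSemidef ∧ P.trace = 1 ∧
        Tᴴ * T * P = P ∧ ∀ A ∈ W, ((T * P)ᴴ * A).trace = 0 := by
  constructor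
  · intro h
    let b := Module.finBasis 𝕜 W
    let Φ : Matrix (Fin n) (Fin n) 𝕜 →ₗ[ℝ] Fin (Module.finrank 𝕜 W) → 𝕜 :=
      { toFun P i := ((T * P)ᴴ * (b i : Matrix (Fin n) (Fin n) 𝕜)).trace
        map_add' P Q := by
          ext i
          simp only [Matrix.mul_add, conjTranspose_add, Matrix.add_mul, trace_add, Pi.add_apply]
        map_smul' s P := by
          ext i
          simp only [Matrix.mul_smul, conjTranspose_smul, star_trivial, Matrix.smul_mul, trace_smul,
            Pi.smul_apply, RingHom.id_apply] }
    have hΦ : Continuous Φ := by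
      change Continuous fun P i ↦ ((T * P)ᴴ * (b i : Matrix (Fin n) (Fin n) 𝕜)).trace
      fun_prop
    have hmem : 0 ∈ Φ '' normAttainingDensity T := by
      by_contra h0
      obtain ⟨f, u, hf, hu⟩ := RCLike.geometric_hahn_banach_closed_point (𝕜 := 𝕜)
        ((convex_normAttainingDensity T).linear_image Φ)
        ((isCompact_normAttainingDensity T).image hΦ).isClosed h0
      rw [map_zero, map_zero] at hu
      let A : W := ∑ i, f (Pi.single i 1) • b i
      obtain ⟨x, hx, hTx, hre⟩ :=
        ContinuousLinearMap.exists_norm_apply_eq_one_of_one_le_norm_add_smul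
          (toEuclideanCLM (𝕜 := 𝕜) T) (toEuclideanCLM (𝕜 := 𝕜) (A : Matrix (Fin n) (Fin n) 𝕜)) hT
          (fun t ↦ by simpa only [hT, map_add, map_smul] using h A A.2 (t : 𝕜))
      have hfx : f (Φ (vecMulVec x.ofLp (star x.ofLp))) = ⟪toEuclideanCLM (𝕜 := 𝕜) T x,
          toEuclideanCLM (𝕜 := 𝕜) (A : Matrix (Fin n) (Fin n) 𝕜) x⟫_𝕜 := by
        have hΦx : Φ (vecMulVec x.ofLp (star x.ofLp)) = fun i ↦ ⟪toEuclideanCLM (𝕜 := 𝕜) T x,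
            toEuclideanCLM (𝕜 := 𝕜) (b i : Matrix (Fin n) (Fin n) 𝕜) x⟫_𝕜 :=
          funext fun i ↦ trace_conjTranspose_mul_vecMulVec_star_mul T (b i) x.ofLp
        rw [pi_eq_sum_univ' (Φ _), hΦx]
        simp [A, inner_sum, inner_smul_right, mul_comm]
      have := hf _ ⟨_, vecMulVec_star_mem_normAttainingDensity hT.le hx hTx, rfl⟩
      rw [hfx] at this
      linarith
    obtain ⟨P, ⟨hP, hPt, hPT⟩, hP0⟩ := hmem
    have hPb (i) : ((T * P)ᴴ * (b i : Matrix (Fin n) (Fin n) 𝕜)).trace = 0 := congrFun hP0 i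
    refine ⟨P, hP, hPt, hPT, fun A hA ↦ ?_⟩
    have hrepr := congrArg (Subtype.val : W → _) (b.sum_repr ⟨A, hA⟩)
    simp only [Submodule.coe_sum, Submodule.coe_smul] at hrepr
    rw [← hrepr, Matrix.mul_sum, trace_sum]
    exact Finset.sum_eq_zero fun i _ ↦ by rw [Matrix.mul_smul, trace_smul, hPb i]; simp
  · rintro ⟨P, hP, hPt, hPT, hPW⟩ A hA c
    have key : ((T * P)ᴴ * (T + c • A)).trace = 1 := by
      rw [Matrix.mul_add, Matrix.mul_smul, trace_add, trace_smul, hPW A hA, smul_zero, add_zero,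
        conjTranspose_mul, hP.isHermitian.eq, Matrix.mul_assoc, trace_mul_comm, hPT, hPt]
    have := hP.norm_trace_conjTranspose_mul_le hPt T (T + c • A)
    rw [key, norm_one, hT, one_mul] at this
    rwa [hT]
end

section
/- Let X and Y be Banach spaces over K (ℝ or ℂ), T ∈ L(X,Y) with ‖T‖ = 1, and W a linear subspace of L(X,Y). Suppose there exist a natural number h ≥ 1, vectors x_1,…,x_h ∈ M_T, functionals y_i* ∈ J(T x_i) for 1 ≤ i ≤ h, and scalars λ_1,…,λ_h > 0 with ∑_{i=1}^h λ_i = 1, such that ∑_{i=1}^h λ_i y_i*(A x_i) = 0 for every A ∈ W. Then T ⊥_B W. -/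
/-- **Sufficient condition for Birkhoff–James orthogonality to a subspace of
operators between arbitrary Banach spaces.**
Let `T ∈ L(X,Y)` with `‖T‖ = 1` and let `W` be a subspace of `L(X,Y)`. If there
exist `h ≥ 1`, `x_i ∈ M_T`, `y_i* ∈ J(T x_i)` and `λ_i > 0` with `∑ λ_i = 1`
such that `∑ λ_i y_i*(A x_i) = 0` for all `A ∈ W`, then `T ⊥_B W`. -/
theorem birkhoff_orthogonality_subspace_sufficient
    {𝕜 X Y : Type*} [RCLike 𝕜]
    [NormedAddCommGroup X] [NormedSpace 𝕜 X] [CompleteSpace X]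
    [NormedAddCommGroup Y] [NormedSpace 𝕜 Y] [CompleteSpace Y]
    (T : X →L[𝕜] Y) (hT : ‖T‖ = 1)
    (W : Submodule 𝕜 (X →L[𝕜] Y))
    (h : ℕ) (hh : 1 ≤ h) (x : Fin h → X) (ystar : Fin h → (Y →L[𝕜] 𝕜))
    (lam : Fin h → ℝ)
    (hx : ∀ i, ‖x i‖ = 1 ∧ ‖T (x i)‖ = ‖T‖)
    (hy : ∀ i, ‖ystar i‖ = 1 ∧ (ystar i) (T (x i)) = (‖T (x i)‖ : 𝕜))
    (hlam : ∀ i, 0 < lam i) (hsum : ∑ i, lam i = 1)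
    (horth : ∀ A ∈ W, ∑ i, ((lam i : 𝕜)) * (ystar i) (A (x i)) = 0) :
    ∀ A ∈ W, ∀ c : 𝕜, ‖T‖ ≤ ‖T + c • A‖ := by
  intro A hA c
  have key : ∑ i, (lam i : 𝕜) * ystar i ((T + c • A) (x i)) = 1 := by
    calc ∑ i, (lam i : 𝕜) * ystar i ((T + c • A) (x i))
        = ∑ i, (lam i : 𝕜) + c * ∑ i, (lam i : 𝕜) * ystar i (A (x i)) := by
          rw [Finset.mul_sum, ← Finset.sum_add_distrib]
          refine Finset.sum_congr rfl fun i _ => ?_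
          simp only [add_apply, smul_apply, map_add, map_smul, smul_eq_mul, (hy i).2, (hx i).2,
            hT, RCLike.ofReal_one]
          ring
      _ = 1 := by
          rw [horth A hA, mul_zero, add_zero]
          exact_mod_cast congrArg ((↑) : ℝ → 𝕜) hsum
  calc ‖T‖ = ‖∑ i, (lam i : 𝕜) * ystar i ((T + c • A) (x i))‖ := by rw [key, norm_one, hT]
    _ ≤ ∑ i, lam i * ‖T + c • A‖ := by
        refine norm_sum_le_of_le _ fun i _ => ?_
        rw [norm_mul, RCLike.norm_ofReal, abs_of_pos (hlam i)]
        refine mul_le_mul_of_nonneg_left ?_ (hlam i).le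
        calc ‖ystar i ((T + c • A) (x i))‖ ≤ ‖ystar i‖ * ‖(T + c • A) (x i)‖ :=
              (ystar i).le_opNorm _
          _ ≤ 1 * (‖T + c • A‖ * ‖x i‖) := by
              rw [(hy i).1]
              gcongr
              exact (T + c • A).le_opNorm _
          _ = ‖T + c • A‖ := by rw [(hx i).1, one_mul, mul_one]
    _ = ‖T + c • A‖ := by rw [← Finset.sum_mul, hsum, one_mul]
end

section
/- Let H be a complex Hilbert space and T ∈ L(H) with ‖T‖ = 1. Assume M_T = S_{H_0}, the unit sphere of a finite-dimensional nonzero subspace H_0 of H, and that the norm of T restricted to H_0^⊥ is strictly less than ‖T‖. Then dist(T, K(H)) < 1, where K(H) is the space of compact operators on H. -/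
/-- **Claim from Theorem 2.5 of the paper.**
Let `H` be a complex Hilbert space and `T ∈ L(H)` with `‖T‖ = 1`, such that
`M_T = S_{H₀}` for a finite-dimensional nonzero subspace `H₀` and
`‖T|_{H₀^⊥}‖ < ‖T‖`. Then `dist(T, K(H)) < 1`. -/
theorem dist_compactOperators_lt_one
    {H : Type*} [NormedAddCommGroup H] [InnerProductSpace ℂ H] [CompleteSpace H]
    (T : H →L[ℂ] H) (hT : ‖T‖ = 1)
    (H₀ : Submodule ℂ H) (hfin : FiniteDimensional ℂ H₀) (hne : H₀ ≠ ⊥)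
    (hMT : {x : H | ‖x‖ = 1 ∧ ‖T x‖ = ‖T‖} = {x : H | x ∈ H₀ ∧ ‖x‖ = 1})
    (hres : ‖T.comp (H₀ᗮ).subtypeL‖ < ‖T‖) :
    Metric.infDist T {S : H →L[ℂ] H | IsCompactOperator ⇑S} < 1 := by
  have : ProperSpace H₀ := FiniteDimensional.proper ℂ H₀
  let R := T.comp H₀ᗮ.subtypeL
  have hcpt : IsCompactOperator (T.comp (H₀.subtypeL.comp H₀.orthogonalProjectionOnto)) :=
    (isCompactOperator_of_locallyCompactSpace_rng
      (T.comp H₀.subtypeL)).comp_clm H₀.orthogonalProjectionOnto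
  have hdiff : T - T.comp (H₀.subtypeL.comp H₀.orthogonalProjectionOnto) =
      R.comp H₀ᗮ.orthogonalProjectionOnto := by
    ext x
    simp [R]
  calc _ ≤ dist T (T.comp (H₀.subtypeL.comp H₀.orthogonalProjectionOnto)) :=
        Metric.infDist_le_dist_of_mem hcpt
    _ = ‖R.comp H₀ᗮ.orthogonalProjectionOnto‖ := by rw [dist_eq_norm, hdiff]
    _ ≤ ‖R‖ * ‖H₀ᗮ.orthogonalProjectionOnto‖ := R.opNorm_comp_le _
    _ ≤ ‖R‖ := mul_le_of_le_one_right R.opNorm_nonneg H₀ᗮ.orthogonalProjectionOnto_norm_le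
    _ < 1 := hT ▸ hres
end
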